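/- arXiv:2312.14019 — 2 statements merged into one kernel-verified Lean document; each statement's English description precedes it below -/
import Mathlib

section
/- Let m ≥ 1 and n, d : Fin m → ℕ with n_J, d_J ≥ 1 for all J; consider complex matrices indexed by the sigma type H := Σ J : Fin m, (Fin n_J × Fin d_J), and set D := Σ_J n_J·d_J. Let A := {X : there exists a family M_J ∈ M_{d_J}(ℂ) such that X((J,a,l),(K,b,m')) = M_J(l,m') if J = K and a = b, and 0 otherwise}; A is a hermitian-closed unital subalgebra (the block algebra ⊕_J 1_{n_J} ⊗ M_{d_J}(ℂ)). Then the self-MAN NC(A) := S(A : A) satisfies NC(A) = 1 − (1/D) Σ_J n_J/d_J, and consequently NC(A) ≤ 1 − 1/(max_J d_J)² ≤ 1 − 1/D². -/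
open MeasureTheory Matrix Kronecker

noncomputable section

instance matMeasurableSpace (n : Type*) [Fintype n] : MeasurableSpace (Matrix n n ℂ) :=
  show MeasurableSpace (n → n → ℂ) from inferInstance

/-- Squared Frobenius (Hilbert-Schmidt) norm `‖X‖₂² = Tr(X† X)`. -/
def hs2 {n : Type*} [Fintype n] (X : Matrix n n ℂ) : ℝ := (Matrix.trace (Xᴴ * X)).re

/-- Mutual Averaged Non-commutativity: `(1/(2d)) ∫∫ ‖UV - VU‖₂² dμ(U) dν(V)`,
where `μ`, `ν` are meant to be the normalized Haar measures of the unitary groups of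
the two algebras (imposed by the `IsHaar` hypotheses in the theorems below). -/
def MAN {n : Type*} [Fintype n] (μ ν : Measure (Matrix n n ℂ)) : ℝ :=
  (1 / (2 * (Fintype.card n : ℝ))) * ∫ U, ∫ V, hs2 (U * V - V * U) ∂ν ∂μ

/-- `μ` is the normalized Haar probability measure of the compact unitary group
`U(A) = {U ∈ A : U†U = UU† = 1}` of the star-subalgebra `A`, viewed as a measure on
matrix space concentrated on `U(A)` and invariant under left translation by `U(A)`. -/
def IsHaar {n : Type*} [Fintype n] [DecidableEq n] (A : StarSubalgebra ℂ (Matrix n n ℂ))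
    (μ : Measure (Matrix n n ℂ)) : Prop :=
  IsProbabilityMeasure μ ∧
  μ {U | ¬ (U ∈ A ∧ U ∈ unitary (Matrix n n ℂ))} = 0 ∧
  ∀ U ∈ A, U ∈ unitary (Matrix n n ℂ) → μ.map (fun V => U * V) = μ

/-- The block algebra `⊕_J 1_{n_J} ⊗ M_{d_J}(ℂ)` acting on `⊕_J ℂ^{n_J} ⊗ ℂ^{d_J}`. -/
def blockCarrier (m : ℕ) (n dv : Fin m → ℕ) :
    Set (Matrix ((J : Fin m) × (Fin (n J) × Fin (dv J)))
      ((J : Fin m) × (Fin (n J) × Fin (dv J))) ℂ) :=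
  {X | ∃ M : (J : Fin m) → Matrix (Fin (dv J)) (Fin (dv J)) ℂ,
    (∀ p q, p.1 ≠ q.1 → X p q = 0) ∧
    (∀ (J : Fin m) (a b : Fin (n J)) (l l' : Fin (dv J)),
      X ⟨J, (a, l)⟩ ⟨J, (b, l')⟩ = if a = b then M J l l' else 0)}

/-- The block matrix `⊕_J 1_{n_J} ⊗ M_J`. -/
def blockMat {m : ℕ} (n : Fin m → ℕ) {dv : Fin m → ℕ}
    (M : (J : Fin m) → Matrix (Fin (dv J)) (Fin (dv J)) ℂ) :
    Matrix ((J : Fin m) × (Fin (n J) × Fin (dv J)))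
      ((J : Fin m) × (Fin (n J) × Fin (dv J))) ℂ :=
  blockDiagonal' fun J => (1 : Matrix (Fin (n J)) (Fin (n J)) ℂ) ⊗ₖ M J

/-- The `d_J × d_J` corner of `X` at copy `a J` of the `J`-th block. -/
def corner {m : ℕ} {n dv : Fin m → ℕ} (a : ∀ J, Fin (n J)) (J : Fin m)
    (X : Matrix ((J : Fin m) × (Fin (n J) × Fin (dv J)))
      ((J : Fin m) × (Fin (n J) × Fin (dv J))) ℂ) : Matrix (Fin (dv J)) (Fin (dv J)) ℂ :=
  X.submatrix (fun l => ⟨J, (a J, l)⟩) (fun l => ⟨J, (a J, l)⟩)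

section Blocks

variable {m : ℕ} {n dv : Fin m → ℕ}

lemma blockMat_mul (M N : (J : Fin m) → Matrix (Fin (dv J)) (Fin (dv J)) ℂ) :
    blockMat n M * blockMat n N = blockMat n (M * N) := by
  simp only [blockMat, ← blockDiagonal'_mul, ← mul_kronecker_mul, one_mul, Pi.mul_apply]

lemma blockMat_one :
    blockMat n (1 : (J : Fin m) → Matrix (Fin (dv J)) (Fin (dv J)) ℂ) = 1 := by
  rw [← blockDiagonal'_one]
  unfold blockMat
  congr 1
  funext J
  exact one_kronecker_one

lemma blockMat_conjTranspose (M : (J : Fin m) → Matrix (Fin (dv J)) (Fin (dv J)) ℂ) :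
    (blockMat n M)ᴴ = blockMat n fun J => (M J)ᴴ := by
  simp only [blockMat, blockDiagonal'_conjTranspose, conjTranspose_kronecker,
    conjTranspose_one]

lemma trace_blockMat (M : (J : Fin m) → Matrix (Fin (dv J)) (Fin (dv J)) ℂ) :
    (blockMat n M).trace = ∑ J, (n J : ℂ) * (M J).trace := by
  simp [blockMat, trace_blockDiagonal', trace_kronecker]

lemma corner_blockMat (a : ∀ J, Fin (n J))
    (M : (J : Fin m) → Matrix (Fin (dv J)) (Fin (dv J)) ℂ) (J : Fin m) :
    corner a J (blockMat n M) = M J := by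
  ext l l'
  simp [corner, blockMat, blockDiagonal'_apply_eq]

lemma mem_blockCarrier_iff {X : Matrix ((J : Fin m) × (Fin (n J) × Fin (dv J)))
      ((J : Fin m) × (Fin (n J) × Fin (dv J))) ℂ} :
    X ∈ blockCarrier m n dv ↔ ∃ M, X = blockMat n M := by
  constructor
  · rintro ⟨M, h0, h1⟩
    refine ⟨M, ?_⟩
    ext ⟨J, x⟩ ⟨K, y⟩
    by_cases h : J = K
    · subst h
      obtain ⟨a, l⟩ := x
      obtain ⟨b, l'⟩ := y
      rw [h1, blockMat, blockDiagonal'_apply_eq]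
      simp [one_apply]
    · rw [h0 _ _ h, blockMat, blockDiagonal'_apply_ne _ _ _ h]
  · rintro ⟨M, rfl⟩
    refine ⟨M, ?_, ?_⟩
    · rintro ⟨J, x⟩ ⟨K, y⟩ h
      exact blockDiagonal'_apply_ne _ _ _ h
    · intro J a b l l'
      rw [blockMat, blockDiagonal'_apply_eq]
      simp [one_apply]

lemma blockMat_mem_unitary {M : (J : Fin m) → Matrix (Fin (dv J)) (Fin (dv J)) ℂ}
    (hM : ∀ J, M J ∈ unitary (Matrix (Fin (dv J)) (Fin (dv J)) ℂ)) :
    blockMat n M ∈ unitary (Matrix ((J : Fin m) × (Fin (n J) × Fin (dv J)))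
      ((J : Fin m) × (Fin (n J) × Fin (dv J))) ℂ) := by
  rw [Unitary.mem_iff, star_eq_conjTranspose, blockMat_conjTranspose, blockMat_mul, blockMat_mul,
    ← blockMat_one]
  constructor <;> congr 1 <;> funext J
  · exact (Unitary.mem_iff.1 (hM J)).1
  · exact (Unitary.mem_iff.1 (hM J)).2

lemma corner_mem_unitary (a : ∀ J, Fin (n J))
    {M : (J : Fin m) → Matrix (Fin (dv J)) (Fin (dv J)) ℂ}
    (hM : blockMat n M ∈ unitary (Matrix ((J : Fin m) × (Fin (n J) × Fin (dv J)))
      ((J : Fin m) × (Fin (n J) × Fin (dv J))) ℂ)) (J : Fin m) :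
    M J ∈ unitary (Matrix (Fin (dv J)) (Fin (dv J)) ℂ) := by
  rw [Unitary.mem_iff, star_eq_conjTranspose, blockMat_conjTranspose, blockMat_mul, blockMat_mul,
    ← blockMat_one] at hM
  have h1 := congrArg (corner a J) hM.1
  have h2 := congrArg (corner a J) hM.2
  rw [corner_blockMat, corner_blockMat] at h1 h2
  exact Unitary.mem_iff.2 ⟨h1, h2⟩

end Blocks

lemma trace_conjTranspose_mul_conjTranspose_mul {d : Type*} [Fintype d] (U V : Matrix d d ℂ) :
    (Vᴴ * Uᴴ * V * U).trace =
      ∑ i, ∑ l, ∑ k, ∑ j, (star (V j i) * V k l) * (star (U k j) * U l i) := by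
  simp only [trace, diag_apply, mul_apply, conjTranspose_apply, Finset.sum_mul]
  refine Finset.sum_congr rfl fun i _ => Finset.sum_congr rfl fun l _ =>
    Finset.sum_congr rfl fun k _ => Finset.sum_congr rfl fun j _ => ?_
  ring

lemma hs2_commutator {d : Type*} [Fintype d] [DecidableEq d] {U V : Matrix d d ℂ}
    (hU : U ∈ unitary (Matrix d d ℂ)) (hV : V ∈ unitary (Matrix d d ℂ)) :
    hs2 (U * V - V * U) = 2 * Fintype.card d - 2 * ((Vᴴ * Uᴴ * V * U).trace).re := by
  have hU' : Uᴴ * U = 1 := (Unitary.mem_iff.1 hU).1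
  have hV' : Vᴴ * V = 1 := (Unitary.mem_iff.1 hV).1
  have e : (U * V - V * U)ᴴ * (U * V - V * U) =
      1 + 1 - Vᴴ * Uᴴ * V * U - (Vᴴ * Uᴴ * V * U)ᴴ := by
    have h1 : Vᴴ * Uᴴ * (U * V) = 1 := by
      rw [Matrix.mul_assoc, ← Matrix.mul_assoc Uᴴ, hU', Matrix.one_mul, hV']
    have h2 : Uᴴ * Vᴴ * (V * U) = 1 := by
      rw [Matrix.mul_assoc, ← Matrix.mul_assoc Vᴴ, hV', Matrix.one_mul, hU']
    have h3 : (Vᴴ * Uᴴ * V * U)ᴴ = Uᴴ * Vᴴ * (U * V) := by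
      simp [Matrix.mul_assoc]
    rw [h3, conjTranspose_sub, conjTranspose_mul, conjTranspose_mul, Matrix.sub_mul,
      Matrix.mul_sub, Matrix.mul_sub, h1, h2, ← Matrix.mul_assoc (Vᴴ * Uᴴ)]
    abel
  rw [hs2, e, trace_sub, trace_sub, trace_add, trace_one, trace_conjTranspose]
  simp
  ring

section Haar

variable {m : ℕ} {n dv : Fin m → ℕ}
  {A : StarSubalgebra ℂ (Matrix ((J : Fin m) × (Fin (n J) × Fin (dv J)))
      ((J : Fin m) × (Fin (n J) × Fin (dv J))) ℂ)}
  {μ ν : Measure (Matrix ((J : Fin m) × (Fin (n J) × Fin (dv J)))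
      ((J : Fin m) × (Fin (n J) × Fin (dv J))) ℂ)}

lemma IsHaar.ae_mem {d : Type*} [Fintype d] [DecidableEq d]
    {B : StarSubalgebra ℂ (Matrix d d ℂ)} {ρ : Measure (Matrix d d ℂ)} (hρ : IsHaar B ρ) :
    ∀ᵐ U ∂ρ, U ∈ B ∧ U ∈ unitary (Matrix d d ℂ) :=
  hρ.2.1

lemma measurable_matrix_apply {d : Type*} [Fintype d] (i j : d) :
    Measurable fun U : Matrix d d ℂ => U i j :=
  (measurable_pi_apply j).comp (measurable_pi_apply (X := fun _ : d => d → ℂ) i)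

lemma measurable_matrix_mul_left {d : Type*} [Fintype d] (W : Matrix d d ℂ) :
    Measurable fun U : Matrix d d ℂ => W * U := by
  refine measurable_pi_lambda _ fun i => measurable_pi_lambda _ fun j => ?_
  simp only [mul_apply]
  exact Finset.measurable_fun_sum _ fun k _ => (measurable_matrix_apply k j).const_mul _

lemma IsHaar.integral_mul_left {d : Type*} [Fintype d] [DecidableEq d]
    {B : StarSubalgebra ℂ (Matrix d d ℂ)} {ρ : Measure (Matrix d d ℂ)} (hρ : IsHaar B ρ)
    {W : Matrix d d ℂ} (hW : W ∈ B) (hW' : W ∈ unitary (Matrix d d ℂ))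
    {f : Matrix d d ℂ → ℂ} (hf : Measurable f) :
    ∫ U, f (W * U) ∂ρ = ∫ U, f U ∂ρ := by
  conv_rhs => rw [← hρ.2.2 W hW hW']
  exact (integral_map (measurable_matrix_mul_left W).aemeasurable hf.aestronglyMeasurable).symm

/-- Almost every element of the unitary group of the block algebra comes from a family of
unitaries. -/
lemma IsHaar.ae_eq_blockMat (hA : (A : Set (Matrix ((J : Fin m) × (Fin (n J) × Fin (dv J)))
      ((J : Fin m) × (Fin (n J) × Fin (dv J))) ℂ)) = blockCarrier m n dv)
    (hμ : IsHaar A μ) (a : ∀ J, Fin (n J)) :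
    ∀ᵐ U ∂μ, U = blockMat n (fun J => corner a J U) ∧
      ∀ J, corner a J U ∈ unitary (Matrix (Fin (dv J)) (Fin (dv J)) ℂ) := by
  filter_upwards [hμ.ae_mem] with U hU
  have h : U ∈ blockCarrier m n dv := hA ▸ hU.1
  obtain ⟨M, rfl⟩ := mem_blockCarrier_iff.1 h
  simp only [corner_blockMat, true_and]
  exact corner_mem_unitary a hU.2

lemma measurable_corner_mul (a : ∀ J, Fin (n J)) (J : Fin m) (l i l' i' : Fin (dv J)) :
    Measurable fun U => star (corner a J U l i) * corner a J U l' i' :=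
  (continuous_star.measurable.comp (measurable_matrix_apply _ _)).mul (measurable_matrix_apply _ _)

lemma IsHaar.integrable_corner_mul
    (hA : (A : Set (Matrix ((J : Fin m) × (Fin (n J) × Fin (dv J)))
      ((J : Fin m) × (Fin (n J) × Fin (dv J))) ℂ)) = blockCarrier m n dv)
    (hμ : IsHaar A μ) (a : ∀ J, Fin (n J)) (J : Fin m) (l i l' i' : Fin (dv J)) :
    Integrable (fun U => star (corner a J U l i) * corner a J U l' i') μ := by
  have := hμ.1
  refine Integrable.of_bound (measurable_corner_mul a J l i l' i').aestronglyMeasurable 1 ?_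
  filter_upwards [hμ.ae_eq_blockMat hA a] with U hU
  rw [norm_mul, norm_star]
  exact mul_le_one₀ (entry_norm_bound_of_unitary (hU.2 J) _ _) (norm_nonneg _)
    (entry_norm_bound_of_unitary (hU.2 J) _ _)

/-- Translation invariance read on the `J`-th corner. -/
lemma IsHaar.integral_corner_mul_left
    (hA : (A : Set (Matrix ((J : Fin m) × (Fin (n J) × Fin (dv J)))
      ((J : Fin m) × (Fin (n J) × Fin (dv J))) ℂ)) = blockCarrier m n dv)
    (hμ : IsHaar A μ) (a : ∀ J, Fin (n J)) (J : Fin m) (l i l' i' : Fin (dv J))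
    {w : Matrix (Fin (dv J)) (Fin (dv J)) ℂ} (hw : w ∈ unitary (Matrix _ _ ℂ)) :
    ∫ U, star ((w * corner a J U) l i) * (w * corner a J U) l' i' ∂μ =
      ∫ U, star (corner a J U l i) * corner a J U l' i' ∂μ := by
  set W : (K : Fin m) → Matrix (Fin (dv K)) (Fin (dv K)) ℂ := Function.update 1 J w with hWdef
  have hW : ∀ K, W K ∈ unitary (Matrix (Fin (dv K)) (Fin (dv K)) ℂ) := by
    intro K
    by_cases h : K = J
    · subst h
      simpa [hWdef] using hw
    · simp [hWdef, h, one_mem]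
  have hmem : blockMat n W ∈ A := by
    rw [← SetLike.mem_coe, hA]
    exact mem_blockCarrier_iff.2 ⟨W, rfl⟩
  rw [← hμ.integral_mul_left hmem (blockMat_mem_unitary hW)
    (measurable_corner_mul a J l i l' i')]
  refine integral_congr_ae ?_
  filter_upwards [hμ.ae_eq_blockMat hA a] with U hU
  have h : corner a J (blockMat n W * U) = w * corner a J U := by
    conv_lhs => rw [hU.1, blockMat_mul, corner_blockMat]
    simp [hWdef]
  rw [h]

/-- Second moments of two entries in one row, scaled by the size of the block. -/
lemma IsHaar.card_mul_integral_corner_mul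
    (hA : (A : Set (Matrix ((J : Fin m) × (Fin (n J) × Fin (dv J)))
      ((J : Fin m) × (Fin (n J) × Fin (dv J))) ℂ)) = blockCarrier m n dv)
    (hμ : IsHaar A μ) (a : ∀ J, Fin (n J)) (J : Fin m) (l i i' : Fin (dv J)) :
    (dv J : ℂ) * ∫ U, star (corner a J U l i) * corner a J U l i' ∂μ =
      (1 : Matrix (Fin (dv J)) (Fin (dv J)) ℂ) i i' := by
  have := hμ.1
  have hrow : ∀ k, ∫ U, star (corner a J U k i) * corner a J U k i' ∂μ =
      ∫ U, star (corner a J U l i) * corner a J U l i' ∂μ := by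
    intro k
    let w : Matrix (Fin (dv J)) (Fin (dv J)) ℂ :=
      (1 : Matrix (Fin (dv J)) (Fin (dv J)) ℂ).submatrix (Equiv.swap l k) id
    have hmul : ∀ (M : Matrix (Fin (dv J)) (Fin (dv J)) ℂ) (j : Fin (dv J)),
        (w * M) l j = M k j := by
      intro M j
      simp [w, mul_apply, one_apply]
    have hw : w ∈ unitary (Matrix (Fin (dv J)) (Fin (dv J)) ℂ) := by
      refine (mem_unitaryGroup_iff (A := w)).2 ?_
      ext x y
      simp [w, mul_apply, one_apply, star_apply, eq_comm]
    simpa only [hmul] using hμ.integral_corner_mul_left hA a J l i l i' hw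
  have hsum : ∑ k, ∫ U, star (corner a J U k i) * corner a J U k i' ∂μ =
      (1 : Matrix (Fin (dv J)) (Fin (dv J)) ℂ) i i' := by
    rw [← integral_finsetSum _ fun k _ => hμ.integrable_corner_mul hA a J k i k i']
    rw [integral_congr_ae (g := fun _ => (1 : Matrix (Fin (dv J)) (Fin (dv J)) ℂ) i i')]
    · simp
    · filter_upwards [hμ.ae_eq_blockMat hA a] with U hU
      rw [← (Unitary.mem_iff.1 (hU.2 J)).1]
      simp [mul_apply, star_apply]
  simp_rw [hrow] at hsum
  simpa using hsum

/-- Second moments of the matrix entries under Haar measure (Weingarten formula of order one). -/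
lemma IsHaar.integral_corner_mul
    (hA : (A : Set (Matrix ((J : Fin m) × (Fin (n J) × Fin (dv J)))
      ((J : Fin m) × (Fin (n J) × Fin (dv J))) ℂ)) = blockCarrier m n dv)
    (hμ : IsHaar A μ) (a : ∀ J, Fin (n J)) (J : Fin m) (l i l' i' : Fin (dv J)) :
    ∫ U, star (corner a J U l i) * corner a J U l' i' ∂μ =
      if l = l' then if i = i' then 1 / (dv J : ℂ) else 0 else 0 := by
  have hd : (dv J : ℂ) ≠ 0 := by
    have := l.pos
    exact_mod_cast this.ne'
  split_ifs with hl hi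
  · subst hl hi
    rw [eq_div_iff hd, mul_comm, hμ.card_mul_integral_corner_mul hA, one_apply_eq]
  · subst hl
    have h := hμ.card_mul_integral_corner_mul hA a J l i i'
    rw [one_apply_ne hi] at h
    exact (mul_eq_zero.1 h).resolve_left hd
  · have hw : diagonal (fun k => if k = l then (-1 : ℂ) else 1) ∈
        unitary (Matrix (Fin (dv J)) (Fin (dv J)) ℂ) := by
      rw [Unitary.mem_iff, star_eq_conjTranspose, diagonal_conjTranspose, diagonal_mul_diagonal,
        diagonal_mul_diagonal, ← diagonal_one]
      constructor <;> congr 1 <;> funext k <;> by_cases hk : k = l <;> simp [hk]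
    have h := hμ.integral_corner_mul_left hA a J l i l' i' hw
    simp only [diagonal_mul, if_true, if_neg (Ne.symm hl), one_mul, neg_mul, star_neg,
      integral_neg] at h
    exact self_eq_neg.1 h.symm

/-- The average over the unitary group of `tr(V† U† V U)` for fixed `U`. -/
lemma IsHaar.integral_corner_trace
    (hA : (A : Set (Matrix ((J : Fin m) × (Fin (n J) × Fin (dv J)))
      ((J : Fin m) × (Fin (n J) × Fin (dv J))) ℂ)) = blockCarrier m n dv)
    (hν : IsHaar A ν) (a : ∀ J, Fin (n J)) (J : Fin m)
    (u : Matrix (Fin (dv J)) (Fin (dv J)) ℂ) :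
    Integrable (fun V => ((corner a J V)ᴴ * uᴴ * corner a J V * u).trace) ν ∧
    ∫ V, ((corner a J V)ᴴ * uᴴ * corner a J V * u).trace ∂ν =
      1 / (dv J : ℂ) * ∑ i, ∑ k, star (u k k) * u i i := by
  have hintegrable : ∀ i l k j : Fin (dv J), Integrable (fun V =>
      (star (corner a J V j i) * corner a J V k l) * (star (u k j) * u l i)) ν :=
    fun i l k j => (hν.integrable_corner_mul hA a J j i k l).mul_const _
  simp only [trace_conjTranspose_mul_conjTranspose_mul]
  constructor
  · exact integrable_finsetSum _ fun i _ => integrable_finsetSum _ fun l _ =>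
      integrable_finsetSum _ fun k _ => integrable_finsetSum _ fun j _ => hintegrable i l k j
  rw [integral_finsetSum _ fun i _ => integrable_finsetSum _ fun l _ =>
      integrable_finsetSum _ fun k _ => integrable_finsetSum _ fun j _ => hintegrable i l k j,
    Finset.mul_sum]
  refine Finset.sum_congr rfl fun i _ => ?_
  rw [integral_finsetSum _ fun l _ =>
    integrable_finsetSum _ fun k _ => integrable_finsetSum _ fun j _ => hintegrable i l k j]
  simp_rw [integral_finsetSum _ fun k _ => integrable_finsetSum _ fun j _ => hintegrable i _ k j,
    integral_finsetSum _ fun j _ => hintegrable i _ _ j, integral_mul_const,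
    hν.integral_corner_mul hA a J]
  simp [Finset.sum_ite_eq, Finset.mul_sum, ite_mul]

/-- The average of `tr(V† U† V U)` over both unitaries in a single block is `1 / d_J`. -/
lemma IsHaar.integral_corner_diag
    (hA : (A : Set (Matrix ((J : Fin m) × (Fin (n J) × Fin (dv J)))
      ((J : Fin m) × (Fin (n J) × Fin (dv J))) ℂ)) = blockCarrier m n dv)
    (hμ : IsHaar A μ) (a : ∀ J, Fin (n J)) (J : Fin m) :
    Integrable (fun U => ∑ i, ∑ k, star (corner a J U k k) * corner a J U i i) μ ∧
    ∫ U, ∑ i, ∑ k, star (corner a J U k k) * corner a J U i i ∂μ =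
      ∑ _i : Fin (dv J), 1 / (dv J : ℂ) := by
  have hintegrable := fun i k => hμ.integrable_corner_mul hA a J k k i i
  refine ⟨integrable_finsetSum _ fun i _ => integrable_finsetSum _ fun k _ => hintegrable i k, ?_⟩
  rw [integral_finsetSum _ fun i _ => integrable_finsetSum _ fun k _ => hintegrable i k]
  simp_rw [integral_finsetSum _ fun k _ => hintegrable _ k, hμ.integral_corner_mul hA a J]
  simp

lemma integral_const_sub_two_mul_re {Ω : Type*} [MeasurableSpace Ω] {ρ : Measure Ω}
    [IsProbabilityMeasure ρ] {f : Ω → ℂ} (hf : Integrable f ρ) (c : ℝ) :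
    ∫ x, (c - 2 * (f x).re) ∂ρ = c - 2 * (∫ x, f x ∂ρ).re := by
  have hre : ∫ x, (f x).re ∂ρ = (∫ x, f x ∂ρ).re := integral_re hf
  have hintegrable : Integrable (fun x => 2 * (f x).re) ρ := hf.re.const_mul 2
  rw [integral_sub (integrable_const c) hintegrable, integral_const_mul, hre]
  simp

/-- The self-MAN of the block algebra in terms of the block dimensions. -/
lemma MAN_eq (hn : ∀ J, 1 ≤ n J) (hdv : ∀ J, 1 ≤ dv J)
    (hA : (A : Set (Matrix ((J : Fin m) × (Fin (n J) × Fin (dv J)))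
      ((J : Fin m) × (Fin (n J) × Fin (dv J))) ℂ)) = blockCarrier m n dv)
    (hμ : IsHaar A μ) (hν : IsHaar A ν) :
    MAN μ ν = 1 / (2 * ((∑ J, n J * dv J : ℕ) : ℝ)) *
      (2 * ((∑ J, n J * dv J : ℕ) : ℝ) - 2 * ∑ J, (n J : ℝ) / (dv J)) := by
  have := hμ.1
  have := hν.1
  have hcard : Fintype.card ((J : Fin m) × (Fin (n J) × Fin (dv J))) = ∑ J, n J * dv J := by
    simp [Fintype.card_sigma]
  set D := ∑ J, n J * dv J
  let a : ∀ J, Fin (n J) := fun J => ⟨0, hn J⟩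
  let F : Matrix ((J : Fin m) × (Fin (n J) × Fin (dv J)))
      ((J : Fin m) × (Fin (n J) × Fin (dv J))) ℂ → ℂ := fun U =>
    ∑ J, (n J : ℂ) * (1 / (dv J : ℂ) * ∑ i, ∑ k, star (corner a J U k k) * corner a J U i i)
  have hFint : Integrable F μ := integrable_finsetSum _ fun J _ =>
    ((hμ.integral_corner_diag hA a J).1.const_mul _).const_mul _
  have hF : ∫ U, F U ∂μ = ∑ J, (n J : ℂ) / (dv J : ℂ) := by
    rw [integral_finsetSum _ fun J _ =>
      ((hμ.integral_corner_diag hA a J).1.const_mul _).const_mul _]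
    refine Finset.sum_congr rfl fun J _ => ?_
    have hd : (dv J : ℂ) ≠ 0 := by exact_mod_cast Nat.one_le_iff_ne_zero.1 (hdv J)
    rw [integral_const_mul, integral_const_mul, (hμ.integral_corner_diag hA a J).2]
    simp [hd, div_eq_mul_inv]
  have hinner : ∀ᵐ U ∂μ, ∫ V, hs2 (U * V - V * U) ∂ν = 2 * (D : ℝ) - 2 * (F U).re := by
    filter_upwards [hμ.ae_mem, hμ.ae_eq_blockMat hA a] with U hU hU'
    have hintegrable := fun J => ((hν.integral_corner_trace hA a J (corner a J U)).1.const_mul (n J : ℂ))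
    have h1 : ∫ V, hs2 (U * V - V * U) ∂ν = ∫ V, (2 * (D : ℝ) - 2 * (∑ J, (n J : ℂ) *
        ((corner a J V)ᴴ * (corner a J U)ᴴ * corner a J V * corner a J U).trace).re) ∂ν := by
      refine integral_congr_ae ?_
      filter_upwards [hν.ae_mem, hν.ae_eq_blockMat hA a] with V hV hV'
      rw [hs2_commutator hU.2 hV.2, hcard]
      congr 3
      conv_lhs => rw [hU'.1, hV'.1]
      simp only [blockMat_conjTranspose, blockMat_mul, trace_blockMat, Pi.mul_apply]
    have hintegrable' := integrable_finsetSum Finset.univ fun J _ => hintegrable J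
    rw [h1, integral_const_sub_two_mul_re hintegrable', integral_finsetSum _ fun J _ => hintegrable J]
    simp_rw [integral_const_mul, (hν.integral_corner_trace hA a _ (corner a _ U)).2]
    simp [F]
  have h3 : (∑ J, (n J : ℂ) / (dv J : ℂ)).re = ∑ J, (n J : ℝ) / (dv J : ℝ) := by
    rw [← Complex.ofReal_re (∑ J, (n J : ℝ) / (dv J : ℝ))]
    push_cast
    rfl
  rw [MAN, hcard, integral_congr_ae hinner, integral_const_sub_two_mul_re hFint, hF, h3]

end Haar

/-- Self-MAN of the block algebra: `NC(A) = 1 - (1/D) Σ_J n_J/d_J`, with the bounds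
`NC(A) ≤ 1 - 1/(max_J d_J)² ≤ 1 - 1/D²`. -/
theorem stmt_14 (m : ℕ) (hm : 1 ≤ m) (n dv : Fin m → ℕ)
    (hn : ∀ J, 1 ≤ n J) (hdv : ∀ J, 1 ≤ dv J)
    (A : StarSubalgebra ℂ (Matrix ((J : Fin m) × (Fin (n J) × Fin (dv J)))
      ((J : Fin m) × (Fin (n J) × Fin (dv J))) ℂ))
    (hA : (A : Set (Matrix ((J : Fin m) × (Fin (n J) × Fin (dv J)))
      ((J : Fin m) × (Fin (n J) × Fin (dv J))) ℂ)) = blockCarrier m n dv)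
    (μ ν : Measure (Matrix ((J : Fin m) × (Fin (n J) × Fin (dv J)))
      ((J : Fin m) × (Fin (n J) × Fin (dv J))) ℂ))
    (hμ : IsHaar A μ) (hν : IsHaar A ν) :
    MAN μ ν = 1 - (1 / ((∑ J, n J * dv J : ℕ) : ℝ)) * ∑ J, (n J : ℝ) / (dv J) ∧
    MAN μ ν ≤ 1 - 1 / ((Finset.univ.sup dv : ℕ) : ℝ) ^ 2 ∧
    1 - 1 / ((Finset.univ.sup dv : ℕ) : ℝ) ^ 2 ≤ 1 - 1 / ((∑ J, n J * dv J : ℕ) : ℝ) ^ 2 := by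
  have hD : (0 : ℝ) < ((∑ J, n J * dv J : ℕ) : ℝ) := by
    have h : 0 < n ⟨0, hm⟩ * dv ⟨0, hm⟩ := Nat.mul_pos (hn _) (hdv _)
    exact_mod_cast h.trans_le
      (Finset.single_le_sum (f := fun J => n J * dv J) (fun _ _ => Nat.zero_le _)
        (Finset.mem_univ _))
  have hle : ∀ J, dv J ≤ Finset.univ.sup dv := fun J => Finset.le_sup (Finset.mem_univ J)
  have hmax : (0 : ℝ) < ((Finset.univ.sup dv : ℕ) : ℝ) := by
    exact_mod_cast (hdv ⟨0, hm⟩).trans (hle _)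
  have hsup : Finset.univ.sup dv ≤ ∑ J, n J * dv J := Finset.sup_le fun J _ =>
    (Nat.le_mul_of_pos_left _ (hn J)).trans
      (Finset.single_le_sum (f := fun J => n J * dv J) (fun _ _ => Nat.zero_le _)
        (Finset.mem_univ _))
  have hMAN : MAN μ ν = 1 - (1 / ((∑ J, n J * dv J : ℕ) : ℝ)) * ∑ J, (n J : ℝ) / (dv J) := by
    rw [MAN_eq hn hdv hA hμ hν]
    field_simp
  refine ⟨hMAN, ?_, ?_⟩
  · rw [hMAN]
    refine sub_le_sub_left ?_ 1
    rw [one_div_mul_eq_div, le_div_iff₀ hD]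
    push_cast
    rw [Finset.mul_sum]
    refine Finset.sum_le_sum fun J _ => ?_
    have hd : (0 : ℝ) < dv J := by exact_mod_cast hdv J
    have hdm : (dv J : ℝ) ≤ ((Finset.univ.sup dv : ℕ) : ℝ) := by exact_mod_cast hle J
    rw [one_div_mul_eq_div, div_le_div_iff₀ (pow_pos hmax 2) hd, mul_assoc, ← sq]
    gcongr
  · have h : ((Finset.univ.sup dv : ℕ) : ℝ) ≤ ((∑ J, n J * dv J : ℕ) : ℝ) := by
      exact_mod_cast hsup
    gcongr
end
end

section
/- Let A, B be hermitian-closed unital subalgebras of M_d(ℂ) with A collinear, i.e. dim_ℂ(A)·dim_ℂ(A') = d², and assume dim_ℂ(A) = dim_ℂ(B'). Let P_A and P_{B'} be the Frobenius-orthogonal projections of M_d(ℂ) onto A and onto B'. Then S(A : B) = (1/(2·dim_ℂ(A))) · tr((P_A − P_{B'}) ∘ (P_A − P_{B'})), i.e. the MAN equals (1/(2·dim A)) times the squared Hilbert–Schmidt distance between the two projection maps. -/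
open MeasureTheory Matrix Kronecker

noncomputable section

/-- The commutant `A' = {X : XY = YX ∀ Y ∈ A}` as a ℂ-subspace of matrix space. -/
def commSub {n : Type*} [Fintype n] [DecidableEq n] (A : StarSubalgebra ℂ (Matrix n n ℂ)) :
    Submodule ℂ (Matrix n n ℂ) where
  carrier := {X | ∀ Y ∈ A, X * Y = Y * X}
  add_mem' := by
    intro a b ha hb Y hY
    rw [add_mul, mul_add, ha Y hY, hb Y hY]
  zero_mem' := by
    intro Y hY
    rw [zero_mul, mul_zero]
  smul_mem' := by
    intro c X hX Y hY
    rw [smul_mul_assoc, hX Y hY, mul_smul_comm]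

instance matBorelSpace (n : Type*) [Fintype n] : BorelSpace (Matrix n n ℂ) :=
  show BorelSpace (n → n → ℂ) from inferInstance

section Haar

open scoped Matrix.Norms.L2Operator

variable {n : Type*} [Fintype n] [DecidableEq n]

theorem mem_span_unitary_of_mem (A : StarSubalgebra ℂ (Matrix n n ℂ)) {X : Matrix n n ℂ}
    (hX : X ∈ A) :
    X ∈ Submodule.span ℂ {U : Matrix n n ℂ | U ∈ A ∧ U ∈ unitary (Matrix n n ℂ)} := by
  have hclosed : IsClosed (A : Set (Matrix n n ℂ)) :=
    Submodule.closed_of_finiteDimensional (Subalgebra.toSubmodule A.toSubalgebra)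
  have h : (⟨X, hX⟩ : A) ∈ Submodule.span ℂ (unitary A : Set A) := by
    rw [CStarAlgebra.span_unitary]
    trivial
  have h' := Submodule.mem_map_of_mem (f := A.subtype.toAlgHom.toLinearMap) h
  rw [Submodule.map_span] at h'
  refine Submodule.span_mono ?_ h'
  rintro _ ⟨U, hU, rfl⟩
  have hU' := Unitary.mem_iff.mp hU
  exact ⟨U.2, Unitary.mem_iff.mpr ⟨congrArg Subtype.val hU'.1, congrArg Subtype.val hU'.2⟩⟩

variable {A : StarSubalgebra ℂ (Matrix n n ℂ)} {μ : Measure (Matrix n n ℂ)}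
  {E : Type*} [NormedAddCommGroup E]

theorem IsHaar.ae_mem_s17 (hμ : IsHaar A μ) :
    ∀ᵐ U ∂μ, U ∈ A ∧ U ∈ unitary (Matrix n n ℂ) :=
  hμ.2.1

theorem IsHaar.integrable (hμ : IsHaar A μ) {f : Matrix n n ℂ → E} (hf : Continuous f) :
    Integrable f μ := by
  have := hμ.1
  have hproper : ProperSpace (Matrix n n ℂ) := FiniteDimensional.proper ℂ _
  obtain ⟨C, hC⟩ := (isCompact_closedBall (0 : Matrix n n ℂ) 1).exists_bound_of_continuousOn
    hf.continuousOn
  refine Integrable.of_bound hf.aestronglyMeasurable C ?_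
  filter_upwards [hμ.ae_mem_s17] with U hU
  refine hC U ?_
  rw [mem_closedBall_zero_iff]
  rcases isEmpty_or_nonempty n with h | h
  · rw [Subsingleton.elim U 0, norm_zero]
    exact zero_le_one
  · exact (CStarRing.norm_of_mem_unitary hU.2).le

variable [NormedSpace ℂ E]

theorem IsHaar.integral_mul_left_s17 (hμ : IsHaar A μ) {W : Matrix n n ℂ} (hWA : W ∈ A)
    (hW : W ∈ unitary (Matrix n n ℂ)) {f : Matrix n n ℂ → E} (hf : Continuous f) :
    ∫ U, f (W * U) ∂μ = ∫ U, f U ∂μ := by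
  have hc : Continuous fun U : Matrix n n ℂ => W * U := by fun_prop
  conv_rhs => rw [← hμ.2.2 W hWA hW]
  rw [integral_map hc.aemeasurable hf.aestronglyMeasurable]

theorem IsHaar.integral_linearMap [FiniteDimensional ℂ E] {F : Type*} [NormedAddCommGroup F]
    [NormedSpace ℂ F] [CompleteSpace F] (hμ : IsHaar A μ) {f : Matrix n n ℂ → E} (hf : Continuous f)
    (L : E →ₗ[ℂ] F) : ∫ U, L (f U) ∂μ = L (∫ U, f U ∂μ) := by
  have : CompleteSpace E := FiniteDimensional.complete ℂ E
  exact (LinearMap.toContinuousLinearMap L).integral_comp_comm (hμ.integrable hf)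

end Haar

section Projection

open scoped ComplexOrder

variable {n : Type*} [Fintype n]

theorem star_trace_conjTranspose_mul (X Y : Matrix n n ℂ) :
    star (Xᴴ * Y).trace = (Yᴴ * X).trace := by
  rw [← trace_conjTranspose, conjTranspose_mul, conjTranspose_conjTranspose]

/-- `P` is the Frobenius-orthogonal projection onto `S`. -/
structure IsFrobeniusProj (S : Submodule ℂ (Matrix n n ℂ))
    (P : Matrix n n ℂ →ₗ[ℂ] Matrix n n ℂ) : Prop where
  mem : ∀ X, P X ∈ S
  orthogonal : ∀ X, ∀ Y ∈ S, (Yᴴ * (X - P X)).trace = 0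

namespace IsFrobeniusProj

variable {S : Submodule ℂ (Matrix n n ℂ)} {P : Matrix n n ℂ →ₗ[ℂ] Matrix n n ℂ}

theorem trace_mul (hP : IsFrobeniusProj S P) (X : Matrix n n ℂ) {Y : Matrix n n ℂ} (hY : Y ∈ S) :
    (Yᴴ * P X).trace = (Yᴴ * X).trace := by
  have h := hP.orthogonal X Y hY
  rw [mul_sub, trace_sub, sub_eq_zero] at h
  exact h.symm

theorem eq_of_orthogonal (hP : IsFrobeniusProj S P) {X Z : Matrix n n ℂ} (hZ : Z ∈ S)
    (h : ∀ Y ∈ S, (Yᴴ * Z).trace = (Yᴴ * X).trace) : P X = Z := by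
  have hmem := S.sub_mem (hP.mem X) hZ
  rw [← sub_eq_zero, ← trace_conjTranspose_mul_self_eq_zero_iff, mul_sub, trace_sub,
    hP.trace_mul X hmem, h _ hmem, sub_self]

theorem apply_of_mem (hP : IsFrobeniusProj S P) {X : Matrix n n ℂ} (hX : X ∈ S) : P X = X :=
  hP.eq_of_orthogonal hX fun _ _ => rfl

theorem isProj (hP : IsFrobeniusProj S P) : LinearMap.IsProj S P :=
  ⟨hP.mem, fun _ hX => hP.apply_of_mem hX⟩

theorem trace_eq_finrank (hP : IsFrobeniusProj S P) :
    LinearMap.trace ℂ (Matrix n n ℂ) P = Module.finrank ℂ S :=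
  hP.isProj.trace

theorem comp_self (hP : IsFrobeniusProj S P) : P ∘ₗ P = P :=
  LinearMap.ext fun X => hP.apply_of_mem (hP.mem X)

theorem trace_sub_comp_sub {T : Submodule ℂ (Matrix n n ℂ)}
    {Q : Matrix n n ℂ →ₗ[ℂ] Matrix n n ℂ} (hP : IsFrobeniusProj S P) (hQ : IsFrobeniusProj T Q) :
    LinearMap.trace ℂ (Matrix n n ℂ) ((P - Q) ∘ₗ (P - Q)) =
      Module.finrank ℂ S + Module.finrank ℂ T -
        2 * LinearMap.trace ℂ (Matrix n n ℂ) (Q ∘ₗ P) := by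
  rw [LinearMap.sub_comp, LinearMap.comp_sub, LinearMap.comp_sub, hP.comp_self, hQ.comp_self]
  simp only [map_sub, hP.trace_eq_finrank, hQ.trace_eq_finrank]
  have h : LinearMap.trace ℂ (Matrix n n ℂ) (P ∘ₗ Q) = LinearMap.trace ℂ _ (Q ∘ₗ P) :=
    LinearMap.trace_mul_comm ℂ P Q
  rw [h]
  ring

theorem ofReal_hs2 (hP : IsFrobeniusProj S P) (X : Matrix n n ℂ) :
    (hs2 (P X) : ℂ) = (Xᴴ * P X).trace := by
  have h : (Xᴴ * P X).trace = ((P X)ᴴ * P X).trace := by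
    rw [← star_trace_conjTranspose_mul, ← hP.trace_mul X (hP.mem X),
      star_trace_conjTranspose_mul]
  rw [h, hs2]
  refine Complex.conj_eq_iff_re.mp ?_
  exact star_trace_conjTranspose_mul _ _

end IsFrobeniusProj

variable [DecidableEq n]

theorem trace_eq_sum_apply_single (Φ : Matrix n n ℂ →ₗ[ℂ] Matrix n n ℂ) :
    LinearMap.trace ℂ (Matrix n n ℂ) Φ = ∑ i, ∑ j, Φ (single i j 1) i j := by
  rw [LinearMap.trace_eq_matrix_trace ℂ (Matrix.stdBasis ℂ n n), Matrix.trace,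
    Fintype.sum_prod_type]
  refine Finset.sum_congr rfl fun i _ => Finset.sum_congr rfl fun j _ => ?_
  rw [Matrix.diag_apply, LinearMap.toMatrix_apply, stdBasis_eq_single]
  simp [Matrix.stdBasis]

theorem map_eq_sum_single (Φ : Matrix n n ℂ →ₗ[ℂ] Matrix n n ℂ) (X : Matrix n n ℂ) :
    Φ X = ∑ i, ∑ j, X i j • Φ (single i j 1) := by
  conv_lhs => rw [matrix_eq_sum_single X]
  simp only [map_sum]
  refine Finset.sum_congr rfl fun i _ => Finset.sum_congr rfl fun j _ => ?_
  rw [← map_smul, smul_single, smul_eq_mul, mul_one]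

theorem trace_conjTranspose_mul_single (X : Matrix n n ℂ) (i j : n) :
    (Xᴴ * single i j 1).trace = star (X i j) := by
  rw [trace_mul_single, conjTranspose_apply, MulOpposite.op_one, one_smul]

namespace IsFrobeniusProj

variable {S : Submodule ℂ (Matrix n n ℂ)} {P : Matrix n n ℂ →ₗ[ℂ] Matrix n n ℂ}

theorem trace_conjTranspose_mul_map_single (hP : IsFrobeniusProj S P) {X : Matrix n n ℂ}
    (hX : X ∈ S) (i j : n) : (Xᴴ * P (single i j 1)).trace = star (X i j) := by
  rw [hP.trace_mul _ hX, trace_conjTranspose_mul_single]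

/-- The operator `∑ fᴴ f` for the Parseval frame of `S` obtained by projecting the matrix units. -/
def frameSum (P : Matrix n n ℂ →ₗ[ℂ] Matrix n n ℂ) : Matrix n n ℂ :=
  ∑ i, ∑ j, (P (single i j 1))ᴴ * P (single i j 1)

theorem posSemidef_frameSum (P : Matrix n n ℂ →ₗ[ℂ] Matrix n n ℂ) : (frameSum P).PosSemidef :=
  posSemidef_sum _ fun _ _ => posSemidef_sum _ fun _ _ => posSemidef_conjTranspose_mul_self _

theorem trace_frameSum (hP : IsFrobeniusProj S P) :
    (frameSum P).trace = Module.finrank ℂ S := by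
  have h : star (LinearMap.trace ℂ (Matrix n n ℂ) P) = Module.finrank ℂ S := by
    rw [hP.trace_eq_finrank, star_natCast]
  rw [← h, trace_eq_sum_apply_single, frameSum]
  simp only [trace_sum, star_sum, hP.trace_conjTranspose_mul_map_single (hP.mem _)]

end IsFrobeniusProj

/-- Equality case of `Tr e * Tr e⁻¹ ≥ (card n)²`: if it is attained then `e⁻¹` is scalar. -/
theorem eq_smul_one_of_trace_mul_trace_eq {e c : Matrix n n ℂ} (he : e.PosSemidef)
    (hec : e * c = 1) {D : ℝ} (hD : e.trace = D) (hD0 : D ≠ 0)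
    (h : e.trace * c.trace = (Fintype.card n : ℂ) ^ 2) :
    c = ((Fintype.card n : ℂ) / D) • (1 : Matrix n n ℂ) := by
  rcases isEmpty_or_nonempty n with hn | hn
  · exact Subsingleton.elim _ _
  have hce : c * e = 1 := mul_eq_one_comm.mp hec
  have hDC : (D : ℂ) ≠ 0 := by exact_mod_cast hD0
  have hn0 : (Fintype.card n : ℂ) ≠ 0 := by exact_mod_cast Fintype.card_ne_zero
  set t : ℂ := (D : ℂ) / Fintype.card n with ht
  have ht0 : t ≠ 0 := div_ne_zero hDC hn0
  set M : Matrix n n ℂ := e - t • 1 with hM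
  have htstar : star t = t := by simp [ht]
  have hMH : Mᴴ = M := by
    rw [hM, conjTranspose_sub, he.isHermitian.eq, conjTranspose_smul, conjTranspose_one, htstar]
  have hc : c.PosSemidef := by
    rw [← Matrix.inv_eq_right_inv hec]
    exact he.inv
  have hpos : (Mᴴ * c * M).PosSemidef := hc.conjTranspose_mul_mul_same M
  have hexp : Mᴴ * c * M = e - (2 * t) • 1 + t ^ 2 • c := by
    rw [hMH, hM, sub_mul, hec, smul_mul_assoc, one_mul, mul_sub, sub_mul, sub_mul, one_mul,
      smul_mul_assoc, hce, mul_smul_comm, mul_one, mul_smul_comm, mul_one, smul_smul]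
    module
  have hctr : c.trace = (Fintype.card n : ℂ) ^ 2 / D := by
    rw [← h, hD, mul_div_cancel_left₀ _ hDC]
  have hzero : Mᴴ * c * M = 0 := by
    rw [← hpos.trace_eq_zero_iff, hexp]
    simp only [trace_add, trace_sub, trace_smul, trace_one, hctr, hD, smul_eq_mul, ht]
    field_simp
    ring
  have hMM : Mᴴ * M = 0 := by
    have : Mᴴ * M = (Mᴴ * c * M) * e := by
      have hcomm : M * e = e * M := by
        rw [hM, sub_mul, mul_sub, smul_mul_assoc, mul_smul_comm, one_mul, mul_one]
      rw [mul_assoc, hcomm, mul_assoc, ← mul_assoc c, hce, one_mul]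
    rw [this, hzero, zero_mul]
  have hM0 : M = 0 := conjTranspose_mul_self_eq_zero.mp hMM
  have het : e = t • 1 := sub_eq_zero.mp hM0
  rw [het, smul_mul_assoc, one_mul] at hec
  rw [← inv_div, ← ht, ← hec, smul_smul, inv_mul_cancel₀ ht0, one_smul]

end Projection

section HaarOperators

open scoped Matrix.Norms.L2Operator

variable {n : Type*} [Fintype n] [DecidableEq n] {A : StarSubalgebra ℂ (Matrix n n ℂ)}
  {μ : Measure (Matrix n n ℂ)}

namespace IsHaar

/-- The twirling map `X ↦ ∫ U X Uᴴ dμ(U)`. -/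
def twirl (hμ : IsHaar A μ) : Matrix n n ℂ →ₗ[ℂ] Matrix n n ℂ where
  toFun X := ∫ U, U * X * Uᴴ ∂μ
  map_add' X Y := by
    simp only [mul_add, add_mul]
    exact integral_add (hμ.integrable (by fun_prop)) (hμ.integrable (by fun_prop))
  map_smul' c X := by
    simp only [mul_smul_comm, smul_mul_assoc, integral_smul, RingHom.id_apply]

/-- The frame operator `X ↦ ∫ ⟨U, X⟩ U dμ(U)` of the Haar-distributed unitaries. -/
def frameMap (hμ : IsHaar A μ) : Matrix n n ℂ →ₗ[ℂ] Matrix n n ℂ where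
  toFun X := ∫ U, (Uᴴ * X).trace • U ∂μ
  map_add' X Y := by
    simp only [mul_add, trace_add, add_smul]
    exact integral_add (hμ.integrable (by fun_prop)) (hμ.integrable (by fun_prop))
  map_smul' c X := by
    simp only [mul_smul_comm, trace_smul, smul_assoc, integral_smul, RingHom.id_apply]

theorem twirl_apply (hμ : IsHaar A μ) (X : Matrix n n ℂ) :
    hμ.twirl X = ∫ U, U * X * Uᴴ ∂μ := rfl

theorem frameMap_apply (hμ : IsHaar A μ) (X : Matrix n n ℂ) :
    hμ.frameMap X = ∫ U, (Uᴴ * X).trace • U ∂μ := rfl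

theorem map_twirl {F : Type*} [NormedAddCommGroup F] [NormedSpace ℂ F] [CompleteSpace F]
    (hμ : IsHaar A μ) (L : Matrix n n ℂ →ₗ[ℂ] F) (X : Matrix n n ℂ) :
    L (hμ.twirl X) = ∫ U, L (U * X * Uᴴ) ∂μ :=
  (hμ.integral_linearMap (by fun_prop) L).symm

theorem map_frameMap {F : Type*} [NormedAddCommGroup F] [NormedSpace ℂ F] [CompleteSpace F]
    (hμ : IsHaar A μ) (L : Matrix n n ℂ →ₗ[ℂ] F) (X : Matrix n n ℂ) :
    L (hμ.frameMap X) = ∫ U, (Uᴴ * X).trace • L U ∂μ := by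
  rw [frameMap_apply, ← hμ.integral_linearMap (by fun_prop) L]
  simp only [map_smul]

theorem twirl_mem_commSub (hμ : IsHaar A μ) (X : Matrix n n ℂ) : hμ.twirl X ∈ commSub A := by
  intro Y hY
  have hspan := mem_span_unitary_of_mem A hY
  clear hY
  induction hspan using Submodule.span_induction with
  | mem W hW =>
    have h : W * hμ.twirl X * Wᴴ = hμ.twirl X := by
      have h1 := hμ.map_twirl (LinearMap.mulRight ℂ Wᴴ ∘ₗ LinearMap.mulLeft ℂ W) X
      simp only [LinearMap.comp_apply, LinearMap.mulLeft_apply, LinearMap.mulRight_apply] at h1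
      rw [h1, twirl_apply,
        ← hμ.integral_mul_left_s17 hW.1 hW.2 (f := fun U => U * X * Uᴴ) (by fun_prop)]
      simp only [conjTranspose_mul, mul_assoc]
    calc hμ.twirl X * W = W * hμ.twirl X * Wᴴ * W := by rw [h]
      _ = W * hμ.twirl X := by
        rw [mul_assoc _ Wᴴ, ← star_eq_conjTranspose, Unitary.star_mul_self_of_mem hW.2, mul_one]
  | zero => simp
  | add Y Z _ _ hY hZ => rw [mul_add, add_mul, hY, hZ]
  | smul c Y _ hY => rw [mul_smul_comm, smul_mul_assoc, hY]

theorem isFrobeniusProj_twirl (hμ : IsHaar A μ) : IsFrobeniusProj (commSub A) hμ.twirl where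
  mem := hμ.twirl_mem_commSub
  orthogonal X Y hY := by
    have := hμ.1
    have h := hμ.map_twirl (traceLinearMap n ℂ ℂ ∘ₗ LinearMap.mulLeft ℂ Yᴴ) X
    simp only [LinearMap.comp_apply, LinearMap.mulLeft_apply, traceLinearMap_apply] at h
    rw [mul_sub, trace_sub, h, sub_eq_zero]
    have hconst : ∀ᵐ U ∂μ, (Yᴴ * (U * X * Uᴴ)).trace = (Yᴴ * X).trace := by
      filter_upwards [hμ.ae_mem_s17] with U hU
      have hcomm : Uᴴ * Yᴴ = Yᴴ * Uᴴ := by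
        rw [← conjTranspose_mul, ← conjTranspose_mul, hY U hU.1]
      rw [← mul_assoc, trace_mul_comm, ← mul_assoc, ← mul_assoc, hcomm, mul_assoc Yᴴ,
        ← star_eq_conjTranspose U, Unitary.star_mul_self_of_mem hU.2, mul_one]
    rw [integral_congr_ae hconst, integral_const, probReal_univ, one_smul]

theorem trace_twirl (hμ : IsHaar A μ) :
    LinearMap.trace ℂ (Matrix n n ℂ) hμ.twirl = (hμ.frameMap 1).trace := by
  have h := hμ.map_frameMap (traceLinearMap n ℂ ℂ) 1
  simp only [traceLinearMap_apply] at h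
  rw [h, trace_eq_sum_apply_single]
  have hentry (i j : n) : hμ.twirl (single i j 1) i j = ∫ U, U i i * star (U j j) ∂μ := by
    have := hμ.map_twirl (entryLinearMap ℂ ℂ i j) (single i j 1)
    simp only [entryLinearMap_apply] at this
    rw [this]
    simp [mul_apply, single_apply, Finset.sum_ite_eq, ite_and]
  simp only [hentry]
  have hint (i j : n) : Integrable (fun U : Matrix n n ℂ => U i i * star (U j j)) μ :=
    hμ.integrable (by fun_prop)
  simp_rw [← integral_finsetSum _ fun j _ => hint _ j]
  rw [← integral_finsetSum _ fun i _ => integrable_finsetSum _ fun j _ => hint i j]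
  congr 1 with U
  rw [mul_one, trace_conjTranspose, smul_eq_mul, mul_comm, trace, star_sum, Finset.sum_mul_sum]
  rfl

theorem frameMap_of_mem (hμ : IsHaar A μ) {X : Matrix n n ℂ} (hX : X ∈ A) :
    hμ.frameMap X = X * hμ.frameMap 1 := by
  have hspan := mem_span_unitary_of_mem A hX
  clear hX
  induction hspan using Submodule.span_induction with
  | mem W hW =>
    have h := hμ.map_frameMap (LinearMap.mulLeft ℂ W) 1
    simp only [LinearMap.mulLeft_apply] at h
    rw [h, frameMap_apply, 
      ← hμ.integral_mul_left_s17 hW.1 hW.2 (f := fun U => (Uᴴ * W).trace • U) (by fun_prop)]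
    congr 1 with U : 1
    rw [conjTranspose_mul, mul_assoc, ← star_eq_conjTranspose W,
      Unitary.star_mul_self_of_mem hW.2]
  | zero => simp
  | add Y Z _ _ hY hZ => rw [map_add, add_mul, hY, hZ]
  | smul c Y _ hY => rw [map_smul, smul_mul_assoc, hY]

variable {P : Matrix n n ℂ →ₗ[ℂ] Matrix n n ℂ}

theorem frameMap_proj (hμ : IsHaar A μ)
    (hP : IsFrobeniusProj (Subalgebra.toSubmodule A.toSubalgebra) P) (X : Matrix n n ℂ) :
    hμ.frameMap (P X) = hμ.frameMap X := by
  rw [frameMap_apply, frameMap_apply]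
  refine integral_congr_ae ?_
  filter_upwards [hμ.ae_mem_s17] with U hU
  rw [hP.trace_mul X hU.1]

theorem frameSum_mul_frameMap_one (hμ : IsHaar A μ)
    (hP : IsFrobeniusProj (Subalgebra.toSubmodule A.toSubalgebra) P) :
    IsFrobeniusProj.frameSum P * hμ.frameMap 1 = 1 := by
  have := hμ.1
  have hterm (i j : n) : (P (single i j 1))ᴴ * P (single i j 1) * hμ.frameMap 1 =
      ∫ U, star (U i j) • ((P (single i j 1))ᴴ * U) ∂μ := by
    have h := hμ.map_frameMap (LinearMap.mulLeft ℂ (P (single i j 1))ᴴ) (single i j 1)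
    simp only [LinearMap.mulLeft_apply, trace_conjTranspose_mul_single] at h
    rw [mul_assoc, ← hμ.frameMap_of_mem (hP.mem _), hμ.frameMap_proj hP, h]
  have hint (i j : n) :
      Integrable (fun U : Matrix n n ℂ => star (U i j) • ((P (single i j 1))ᴴ * U)) μ :=
    hμ.integrable (by fun_prop)
  rw [IsFrobeniusProj.frameSum, Finset.sum_mul]
  simp_rw [Finset.sum_mul, hterm, ← integral_finsetSum _ fun j _ => hint _ j]
  rw [← integral_finsetSum _ fun i _ => integrable_finsetSum _ fun j _ => hint i j]
  have hone : ∀ᵐ U ∂μ, ∑ i, ∑ j, star (U i j) • ((P (single i j 1))ᴴ * U) = 1 := by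
    filter_upwards [hμ.ae_mem_s17] with U hU
    simp_rw [← smul_mul_assoc, ← conjTranspose_smul, ← Finset.sum_mul, ← conjTranspose_sum]
    rw [← map_eq_sum_single, hP.apply_of_mem hU.1, ← star_eq_conjTranspose,
      Unitary.star_mul_self_of_mem hU.2]
  rw [integral_congr_ae hone, integral_const, probReal_univ, one_smul]

/-- For a collinear algebra, the frame operator of the Haar unitaries is proportional to the
orthogonal projection. -/
theorem frameMap_eq_smul_proj [Nonempty n] (hμ : IsHaar A μ)
    (hP : IsFrobeniusProj (Subalgebra.toSubmodule A.toSubalgebra) P)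
    (hcol : Module.finrank ℂ (Subalgebra.toSubmodule A.toSubalgebra) *
      Module.finrank ℂ (commSub A) = Fintype.card n ^ 2) :
    hμ.frameMap = ((Fintype.card n : ℂ) /
      Module.finrank ℂ (Subalgebra.toSubmodule A.toSubalgebra)) • P := by
  have hD0 : Module.finrank ℂ (Subalgebra.toSubmodule A.toSubalgebra) ≠ 0 :=
    left_ne_zero_of_mul (hcol ▸ pow_ne_zero 2 Fintype.card_ne_zero)
  have hc := eq_smul_one_of_trace_mul_trace_eq (IsFrobeniusProj.posSemidef_frameSum P)
    (hμ.frameSum_mul_frameMap_one hP)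
    (D := Module.finrank ℂ (Subalgebra.toSubmodule A.toSubalgebra))
    (by rw [hP.trace_frameSum, Complex.ofReal_natCast]) (by exact_mod_cast hD0)
    (by
      rw [hP.trace_frameSum, ← hμ.trace_twirl, hμ.isFrobeniusProj_twirl.trace_eq_finrank]
      exact_mod_cast hcol)
  rw [Complex.ofReal_natCast] at hc
  ext1 X
  rw [← hμ.frameMap_proj hP, hμ.frameMap_of_mem (hP.mem X), hc, mul_smul_comm, mul_one,
    LinearMap.smul_apply]

theorem integral_trace_conjTranspose_mul (hμ : IsHaar A μ)
    (Φ : Matrix n n ℂ →ₗ[ℂ] Matrix n n ℂ) :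
    ∫ U, (Uᴴ * Φ U).trace ∂μ = LinearMap.trace ℂ (Matrix n n ℂ) (Φ ∘ₗ hμ.frameMap) := by
  rw [trace_eq_sum_apply_single]
  have hentry (i j : n) : (Φ ∘ₗ hμ.frameMap) (single i j 1) i j =
      ∫ U, star (U i j) * Φ U i j ∂μ := by
    have h := hμ.map_frameMap (entryLinearMap ℂ ℂ i j ∘ₗ Φ) (single i j 1)
    simpa only [LinearMap.comp_apply, entryLinearMap_apply, trace_conjTranspose_mul_single,
      smul_eq_mul] using h
  have hΦ : Continuous Φ := Φ.continuous_of_finiteDimensional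
  have hint (i j : n) : Integrable (fun U : Matrix n n ℂ => star (U i j) * Φ U i j) μ :=
    hμ.integrable (by fun_prop)
  simp_rw [hentry, ← integral_finsetSum _ fun j _ => hint _ j]
  rw [← integral_finsetSum _ fun i _ => integrable_finsetSum _ fun j _ => hint i j]
  congr 1 with U
  rw [Finset.sum_comm]
  simp only [trace, diag_apply, mul_apply, conjTranspose_apply]

end IsHaar

theorem hs2_mul_sub_mul {U V : Matrix n n ℂ} (hU : U ∈ unitary (Matrix n n ℂ))
    (hV : V ∈ unitary (Matrix n n ℂ)) :
    hs2 (U * V - V * U) = 2 * Fintype.card n - 2 * (Uᴴ * (V * U * Vᴴ)).trace.re := by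
  have hUU : Uᴴ * U = 1 := Unitary.star_mul_self_of_mem hU
  have hVV : Vᴴ * V = 1 := Unitary.star_mul_self_of_mem hV
  have h1 : ((U * V)ᴴ * (U * V)).trace = Fintype.card n := by
    rw [conjTranspose_mul, mul_assoc, ← mul_assoc Uᴴ, hUU, one_mul, hVV, trace_one]
  have h2 : ((V * U)ᴴ * (V * U)).trace = Fintype.card n := by
    rw [conjTranspose_mul, mul_assoc, ← mul_assoc Vᴴ, hVV, one_mul, hUU, trace_one]
  have h3 : ((U * V)ᴴ * (V * U)).trace = (Uᴴ * (V * U * Vᴴ)).trace := by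
    rw [conjTranspose_mul, mul_assoc, trace_mul_comm, mul_assoc]
  have h4 : ((V * U)ᴴ * (U * V)).trace.re = (Uᴴ * (V * U * Vᴴ)).trace.re := by
    rw [← h3, ← star_trace_conjTranspose_mul]
    rfl
  rw [hs2, conjTranspose_sub, sub_mul, mul_sub, mul_sub]
  simp only [trace_sub, Complex.sub_re, h1, h2, h3, h4, Complex.natCast_re]
  ring

theorem integral_hs2_mul_sub_mul {B : StarSubalgebra ℂ (Matrix n n ℂ)}
    {ν : Measure (Matrix n n ℂ)} (hν : IsHaar B ν) {U : Matrix n n ℂ}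
    (hU : U ∈ unitary (Matrix n n ℂ)) :
    ∫ V, hs2 (U * V - V * U) ∂ν = 2 * Fintype.card n - 2 * hs2 (hν.twirl U) := by
  have := hν.1
  have hae : ∀ᵐ V ∂ν, hs2 (U * V - V * U) =
      2 * Fintype.card n - 2 * (Uᴴ * (V * U * Vᴴ)).trace.re := by
    filter_upwards [hν.ae_mem_s17] with V hV
    exact hs2_mul_sub_mul hU hV.2
  have hint : Integrable (fun V : Matrix n n ℂ => (Uᴴ * (V * U * Vᴴ)).trace) ν :=
    hν.integrable (by fun_prop)
  have htr := hν.map_twirl (traceLinearMap n ℂ ℂ ∘ₗ LinearMap.mulLeft ℂ Uᴴ) U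
  simp only [LinearMap.comp_apply, LinearMap.mulLeft_apply, traceLinearMap_apply,
    ← hν.isFrobeniusProj_twirl.ofReal_hs2] at htr
  have hint_re : Integrable (fun V : Matrix n n ℂ => (Uᴴ * (V * U * Vᴴ)).trace.re) ν := hint.re
  have hre : ∫ V, (Uᴴ * (V * U * Vᴴ)).trace.re ∂ν = hs2 (hν.twirl U) := by
    have h : ∫ V, (Uᴴ * (V * U * Vᴴ)).trace.re ∂ν =
        (∫ V, (Uᴴ * (V * U * Vᴴ)).trace ∂ν).re := integral_re hint
    rw [h, ← htr, Complex.ofReal_re]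
  rw [integral_congr_ae hae, integral_sub (integrable_const _) (hint_re.const_mul 2),
    integral_const, probReal_univ, one_smul, integral_const_mul, hre]

theorem man_eq [Nonempty n] {B : StarSubalgebra ℂ (Matrix n n ℂ)} {ν : Measure (Matrix n n ℂ)}
    (hμ : IsHaar A μ) (hν : IsHaar B ν) :
    (MAN μ ν : ℂ) = 1 - (1 / (Fintype.card n : ℂ)) *
      LinearMap.trace ℂ (Matrix n n ℂ) (hν.twirl ∘ₗ hμ.frameMap) := by
  have := hμ.1
  have hn0 : (Fintype.card n : ℂ) ≠ 0 := by exact_mod_cast Fintype.card_ne_zero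
  have hae : ∀ᵐ U ∂μ, ∫ V, hs2 (U * V - V * U) ∂ν =
      2 * Fintype.card n - 2 * hs2 (hν.twirl U) := by
    filter_upwards [hμ.ae_mem_s17] with U hU
    exact integral_hs2_mul_sub_mul hν hU.2
  have hcont : Continuous hν.twirl := hν.twirl.continuous_of_finiteDimensional
  have hint : Integrable (fun U => hs2 (hν.twirl U)) μ :=
    hμ.integrable (Complex.continuous_re.comp (by fun_prop))
  rw [MAN, integral_congr_ae hae, integral_sub (integrable_const _) (hint.const_mul 2),
    integral_const, probReal_univ, one_smul, integral_const_mul,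
    ← hμ.integral_trace_conjTranspose_mul]
  simp only [← hν.isFrobeniusProj_twirl.ofReal_hs2, integral_complex_ofReal]
  push_cast
  field_simp

end HaarOperators

/-- For `A` collinear with `dim A = dim B'`:
`S(A:B) = (1/(2 dim A)) tr((P_A - P_{B'}) ∘ (P_A - P_{B'}))`. -/
theorem stmt_17 (d : ℕ) (hd : 0 < d)
    (A B : StarSubalgebra ℂ (Matrix (Fin d) (Fin d) ℂ))
    (hcol : Module.finrank ℂ ↥(Subalgebra.toSubmodule A.toSubalgebra) *
      Module.finrank ℂ ↥(commSub A) = d ^ 2)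
    (hdim : Module.finrank ℂ ↥(Subalgebra.toSubmodule A.toSubalgebra) =
      Module.finrank ℂ ↥(commSub B))
    (PA PB : Matrix (Fin d) (Fin d) ℂ →ₗ[ℂ] Matrix (Fin d) (Fin d) ℂ)
    (hPA1 : ∀ X, PA X ∈ A)
    (hPA2 : ∀ X, ∀ Y ∈ A, Matrix.trace (Yᴴ * (X - PA X)) = 0)
    (hPB1 : ∀ X, ∀ Y ∈ B, PB X * Y = Y * PB X)
    (hPB2 : ∀ X (Y : Matrix (Fin d) (Fin d) ℂ), (∀ Z ∈ B, Y * Z = Z * Y) →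
      Matrix.trace (Yᴴ * (X - PB X)) = 0)
    (μ ν : Measure (Matrix (Fin d) (Fin d) ℂ))
    (hμ : IsHaar A μ) (hν : IsHaar B ν) :
    (MAN μ ν : ℂ) =
      (1 / (2 * (Module.finrank ℂ ↥(Subalgebra.toSubmodule A.toSubalgebra) : ℂ))) *
        LinearMap.trace ℂ (Matrix (Fin d) (Fin d) ℂ) ((PA - PB) ∘ₗ (PA - PB)) := by
  have : NeZero d := ⟨hd.ne'⟩
  have hPA : IsFrobeniusProj (Subalgebra.toSubmodule A.toSubalgebra) PA := ⟨hPA1, hPA2⟩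
  have hPB : IsFrobeniusProj (commSub B) PB := ⟨hPB1, hPB2⟩
  have hD0 : (Module.finrank ℂ (Subalgebra.toSubmodule A.toSubalgebra) : ℂ) ≠ 0 :=
    Nat.cast_ne_zero.mpr (left_ne_zero_of_mul (hcol ▸ pow_ne_zero 2 hd.ne'))
  have hd0 : (d : ℂ) ≠ 0 := Nat.cast_ne_zero.mpr hd.ne'
  have htwirl : hν.twirl = PB := LinearMap.ext fun X =>
    (hPB.eq_of_orthogonal (hν.twirl_mem_commSub X) fun _ hY =>
      hν.isFrobeniusProj_twirl.trace_mul X hY).symm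
  rw [man_eq hμ hν, htwirl, hμ.frameMap_eq_smul_proj hPA (by rwa [Fintype.card_fin]),
    hPA.trace_sub_comp_sub hPB, ← hdim, LinearMap.comp_smul, map_smul, smul_eq_mul,
    Fintype.card_fin]
  field_simp
  ring
end
end
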